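/- Let X and Y be independent Bernoulli(p) random variables with p \ne 1/2. Then V^2(X+Y) - V^2(X-Y) = 8 (p - p^2)^2 (1-2p)^2 > 0; in particular V^2(X+Y) > V^2(X-Y). -/

import Mathlib

open MeasureTheory

/-- The characteristic function of a law `μ` on `ℝ`. -/
noncomputable def charF (μ : Measure ℝ) (t : ℝ) : ℂ :=
  ∫ x, Complex.exp ((t * x : ℝ) * Complex.I) ∂μ

/-- The distance variance of a real random variable with law `μ`, defined via the
characteristic-function integral `V²(X) = π⁻² ∬ |f(s+t) - f(s)f(t)|² / (s²t²) ds dt`. -/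
noncomputable def distVar (μ : Measure ℝ) : ℝ :=
  (1 / Real.pi ^ 2) *
    ∫ q : ℝ × ℝ, ‖charF μ (q.1 + q.2) - charF μ q.1 * charF μ q.2‖ ^ 2 / (q.1 ^ 2 * q.2 ^ 2)

/-- The Bernoulli distribution with parameter `p`, as a measure on `ℝ`. -/
noncomputable def bern (p : ℝ) : Measure ℝ :=
  ENNReal.ofReal p • Measure.dirac 1 + ENNReal.ofReal (1 - p) • Measure.dirac 0

lemma hker_bound (s : ℝ) : |(1 - Real.cos s) / s ^ 2| ≤ 3 * (1 + s ^ 2)⁻¹ := by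
  have h0 := Real.cos_le_one s
  have h1 := Real.one_sub_sq_div_two_le_cos (x := s)
  have h2 := Real.neg_one_le_cos s
  rw [abs_of_nonneg (div_nonneg (by linarith) (sq_nonneg s))]
  rcases eq_or_ne s 0 with rfl | hs
  · simp
  · have : 0 < s ^ 2 := by positivity
    rw [← div_eq_mul_inv, div_le_div_iff₀ this (by positivity)]
    nlinarith

lemma hker_int : Integrable (fun s : ℝ => (1 - Real.cos s) / s ^ 2) := by
  refine (integrable_inv_one_add_sq.const_mul 3).mono' ?_ (Filter.Eventually.of_forall hker_bound)
  exact (Measurable.aestronglyMeasurable (by fun_prop))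

lemma inner_t (s : ℝ) (hs : 0 < s) :
    IntegrableOn (fun t : ℝ => t * Real.exp (-(s * t))) (Set.Ioi 0) ∧
    ∫ t in Set.Ioi (0:ℝ), t * Real.exp (-(s * t)) = 1 / s ^ 2 := by
  have h := Real.integral_rpow_mul_exp_neg_mul_Ioi (a := 2) (r := s) (by norm_num) hs
  have e : ∀ t : ℝ, t ^ ((2:ℝ) - 1) = t := fun t => by norm_num
  simp only [e] at h
  have g : Real.Gamma 2 = 1 := by
    have := Real.Gamma_nat_eq_factorial 1
    rw [show ((1:ℕ):ℝ) + 1 = 2 by norm_num] at this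
    simpa using this
  rw [g] at h
  have h' : ∫ t in Set.Ioi (0:ℝ), t * Real.exp (-(s * t)) = 1 / s ^ 2 := by
    rw [h]; simp
  refine ⟨?_, h'⟩
  by_contra hc
  have := integral_undef hc
  rw [h'] at this
  have : (1:ℝ) / s ^ 2 ≠ 0 := by positivity
  contradiction

lemma inner_s (t : ℝ) (ht : 0 < t) :
    ∫ s in Set.Ioi (0:ℝ), (1 - Real.cos s) * (t * Real.exp (-(s * t))) = (1 + t ^ 2)⁻¹ := by
  have ha : ((-t : ℂ)).re < 0 := by simpa using ht
  have hb : ((-t + Complex.I : ℂ)).re < 0 := by simpa using ht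
  have ia := integrableOn_exp_mul_complex_Ioi ha 0
  have ib := integrableOn_exp_mul_complex_Ioi hb 0
  have ea := integral_exp_mul_complex_Ioi ha 0
  have eb := integral_exp_mul_complex_Ioi hb 0
  have ed := integral_sub ia ib
  rw [ea, eb] at ed
  have er := congrArg (fun z : ℂ => t * z.re) ed
  have key := integral_re (𝕜 := ℂ) (ia.sub ib)
  simp only [RCLike.re_to_complex, Pi.sub_apply] at key
  rw [← key, ← integral_const_mul] at er
  have e2 : ∀ s : ℝ, t * (Complex.exp (-t * s) - Complex.exp ((-t + Complex.I) * s)).re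
      = (1 - Real.cos s) * (t * Real.exp (-(s * t))) := by
    intro s
    simp [Complex.exp_re]
    ring_nf
  simp only [e2] at er
  rw [er]
  have : t ≠ 0 := ht.ne'
  simp [Complex.div_re, Complex.normSq_apply]
  field_simp
  ring

lemma hker_half : ∫ s in Set.Ioi (0:ℝ), (1 - Real.cos s) / s ^ 2 = Real.pi / 2 := by
  have hF : Integrable (Function.uncurry fun s t : ℝ => (1 - Real.cos s) * (t * Real.exp (-(s * t))))
      ((volume.restrict (Set.Ioi 0)).prod (volume.restrict (Set.Ioi 0))) := by
    rw [integrable_prod_iff (Measurable.aestronglyMeasurable (by unfold Function.uncurry; fun_prop))]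
    constructor
    · filter_upwards [ae_restrict_mem measurableSet_Ioi] with s hs
      exact (inner_t s hs).1.const_mul (1 - Real.cos s)
    · refine hker_int.integrableOn.congr ?_
      filter_upwards [ae_restrict_mem measurableSet_Ioi] with s hs
      simp only [Function.uncurry]
      rw [div_eq_mul_one_div, ← (inner_t s hs).2, ← integral_const_mul]
      refine setIntegral_congr_fun measurableSet_Ioi fun t ht => ?_
      have : 0 < t := ht
      have := Real.cos_le_one s
      exact (Real.norm_of_nonneg (mul_nonneg (by linarith) (by positivity))).symm
  have hsw := integral_integral_swap hF
  have h1 : ∫ s in Set.Ioi (0:ℝ), (1 - Real.cos s) / s ^ 2 =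
      ∫ s in Set.Ioi (0:ℝ), ∫ t in Set.Ioi (0:ℝ), (1 - Real.cos s) * (t * Real.exp (-(s * t))) := by
    refine setIntegral_congr_fun measurableSet_Ioi fun s hs => ?_
    rw [integral_const_mul, (inner_t s hs).2]
    ring
  rw [h1, hsw, setIntegral_congr_fun measurableSet_Ioi (g := fun t : ℝ => (1 + t ^ 2)⁻¹)
    fun t ht => inner_s t ht]
  simp [integral_Ioi_inv_one_add_sq]

lemma hker : ∫ s : ℝ, (1 - Real.cos s) / s ^ 2 = Real.pi := by
  have := integral_comp_abs (f := fun s : ℝ => (1 - Real.cos s) / s ^ 2)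
  simp only [Real.cos_abs, sq_abs] at this
  rw [this, hker_half]; ring

lemma hker_cos_int : Integrable (fun s : ℝ => (1 - Real.cos s) / s ^ 2 * Real.cos s) := by
  refine hker_int.mul_bdd (c := 1) (Measurable.aestronglyMeasurable (by fun_prop)) ?_
  exact Filter.Eventually.of_forall fun s => Real.abs_cos_le_one s

lemma hker_sin_int : Integrable (fun s : ℝ => (1 - Real.cos s) / s ^ 2 * Real.sin s) := by
  refine hker_int.mul_bdd (c := 1) (Measurable.aestronglyMeasurable (by fun_prop)) ?_
  exact Filter.Eventually.of_forall fun s => Real.abs_sin_le_one s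

lemma hker_sin : ∫ s : ℝ, (1 - Real.cos s) / s ^ 2 * Real.sin s = 0 := by
  have := integral_neg_eq_self (fun s : ℝ => (1 - Real.cos s) / s ^ 2 * Real.sin s) volume
  simp only [Real.cos_neg, neg_sq, Real.sin_neg, mul_neg, integral_neg] at this
  linarith

lemma hker_cos : ∫ s : ℝ, (1 - Real.cos s) / s ^ 2 * Real.cos s = 0 := by
  have h2 := Measure.integral_comp_mul_left (fun s : ℝ => (1 - Real.cos s) / s ^ 2) 2
  rw [hker] at h2
  have i2 : Integrable (fun s : ℝ => (1 - Real.cos (2 * s)) / (2 * s) ^ 2) :=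
    hker_int.comp_mul_left' (by norm_num)
  have : ∀ s : ℝ, (1 - Real.cos s) / s ^ 2 * Real.cos s =
      2 * ((1 - Real.cos (2 * s)) / (2 * s) ^ 2) - (1 - Real.cos s) / s ^ 2 := by
    intro s
    rcases eq_or_ne s 0 with rfl | hs
    · simp
    · rw [Real.cos_two_mul]; field_simp; ring
  simp only [this]
  rw [integral_sub (i2.const_mul 2) hker_int, integral_const_mul, h2, hker]
  norm_num
  ring

/-- the double integral -/
lemma dbl (a b c : ℝ) :
    ∫ q : ℝ × ℝ, ((1 - Real.cos q.1) / q.1 ^ 2) * ((1 - Real.cos q.2) / q.2 ^ 2) *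
      (4 * (a ^ 2 + 2 * b ^ 2 + c ^ 2) + 8 * b * (a + c) * (Real.cos q.1 + Real.cos q.2)
        + 8 * a * c * Real.cos (q.1 + q.2) + 8 * b ^ 2 * Real.cos (q.1 - q.2)) =
      Real.pi ^ 2 * (4 * (a ^ 2 + 2 * b ^ 2 + c ^ 2)) := by
  set h : ℝ → ℝ := fun s => (1 - Real.cos s) / s ^ 2 with hh
  set hc : ℝ → ℝ := fun s => (1 - Real.cos s) / s ^ 2 * Real.cos s with hhc
  set hs : ℝ → ℝ := fun s => (1 - Real.cos s) / s ^ 2 * Real.sin s with hhs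
  have j0 : Integrable (fun q : ℝ × ℝ => h q.1 * h q.2) := hker_int.mul_prod hker_int
  have j1 : Integrable (fun q : ℝ × ℝ => hc q.1 * h q.2) := hker_cos_int.mul_prod hker_int
  have j2 : Integrable (fun q : ℝ × ℝ => h q.1 * hc q.2) := hker_int.mul_prod hker_cos_int
  have j3 : Integrable (fun q : ℝ × ℝ => hc q.1 * hc q.2) := hker_cos_int.mul_prod hker_cos_int
  have j4 : Integrable (fun q : ℝ × ℝ => hs q.1 * hs q.2) := hker_sin_int.mul_prod hker_sin_int
  have e : ∀ q : ℝ × ℝ, ((1 - Real.cos q.1) / q.1 ^ 2) * ((1 - Real.cos q.2) / q.2 ^ 2) *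
      (4 * (a ^ 2 + 2 * b ^ 2 + c ^ 2) + 8 * b * (a + c) * (Real.cos q.1 + Real.cos q.2)
        + 8 * a * c * Real.cos (q.1 + q.2) + 8 * b ^ 2 * Real.cos (q.1 - q.2)) =
      (4 * (a ^ 2 + 2 * b ^ 2 + c ^ 2)) * (h q.1 * h q.2) + (8 * b * (a + c)) * (hc q.1 * h q.2)
      + (8 * b * (a + c)) * (h q.1 * hc q.2) + (8 * a * c + 8 * b ^ 2) * (hc q.1 * hc q.2)
      + (8 * b ^ 2 - 8 * a * c) * (hs q.1 * hs q.2) := by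
    intro q
    simp only [hh, hhc, hhs, Real.cos_add, Real.cos_sub]
    ring
  simp only [e]
  rw [integral_add ((((j0.const_mul _).fun_add (j1.const_mul _)).fun_add (j2.const_mul _)).fun_add
      (j3.const_mul _)) (j4.const_mul _),
    integral_add (((j0.const_mul _).fun_add (j1.const_mul _)).fun_add (j2.const_mul _))
      (j3.const_mul _),
    integral_add ((j0.const_mul _).fun_add (j1.const_mul _)) (j2.const_mul _),
    integral_add (j0.const_mul _) (j1.const_mul _)]
  simp only [integral_const_mul, Measure.volume_eq_prod, integral_prod_mul]
  have k0 : ∫ s, h s = Real.pi := hker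
  have k1 : ∫ s, hc s = 0 := hker_cos
  have k2 : ∫ s, hs s = 0 := hker_sin
  rw [k0, k1, k2]; ring

lemma num_norm (a b c s t : ℝ) (u : ℂ) (hu : ‖u‖ = 1) :
    ‖u * ((Complex.exp (s * Complex.I) - 1) * (Complex.exp (t * Complex.I) - 1) *
      (a + b * (Complex.exp (s * Complex.I) + Complex.exp (t * Complex.I)) +
        c * (Complex.exp (s * Complex.I) * Complex.exp (t * Complex.I))))‖ ^ 2 =
      (1 - Real.cos s) * (1 - Real.cos t) *
      (4 * (a ^ 2 + 2 * b ^ 2 + c ^ 2) + 8 * b * (a + c) * (Real.cos s + Real.cos t)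
        + 8 * a * c * Real.cos (s + t) + 8 * b ^ 2 * Real.cos (s - t)) := by
  have h1 : ∀ s : ℝ, ‖Complex.exp (s * Complex.I) - 1‖ ^ 2 = 2 * (1 - Real.cos s) := by
    intro s
    rw [Complex.sq_norm, Complex.normSq_apply]
    simp [Complex.exp_ofReal_mul_I_re, Complex.exp_ofReal_mul_I_im]
    linear_combination Real.sin_sq_add_cos_sq s
  have h2 : ‖(a : ℂ) + b * (Complex.exp (s * Complex.I) + Complex.exp (t * Complex.I)) +
        c * (Complex.exp (s * Complex.I) * Complex.exp (t * Complex.I))‖ ^ 2 =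
      (a ^ 2 + 2 * b ^ 2 + c ^ 2) + 2 * b * (a + c) * (Real.cos s + Real.cos t)
        + 2 * a * c * Real.cos (s + t) + 2 * b ^ 2 * Real.cos (s - t) := by
    rw [Complex.sq_norm, Complex.normSq_apply]
    simp only [Complex.add_re, Complex.mul_re, Complex.add_im, Complex.mul_im, Complex.ofReal_re,
      Complex.ofReal_im, Complex.exp_ofReal_mul_I_re, Complex.exp_ofReal_mul_I_im,
      Real.cos_add, Real.cos_sub]
    have e1 : Real.sin s ^ 2 = 1 - Real.cos s ^ 2 := Real.sin_sq s
    have e2 : Real.sin t ^ 2 = 1 - Real.cos t ^ 2 := Real.sin_sq t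
    ring_nf
    simp only [e1, e2]
    ring
  rw [norm_mul, hu, one_mul, norm_mul, norm_mul, mul_pow, mul_pow, h1, h1, h2]
  ring

lemma distVar_of (μ : Measure ℝ) (a b c : ℝ) (u : ℝ → ℝ → ℂ) (hu : ∀ s t, ‖u s t‖ = 1)
    (h : ∀ s t : ℝ, charF μ (s + t) - charF μ s * charF μ t =
      u s t * ((Complex.exp (s * Complex.I) - 1) * (Complex.exp (t * Complex.I) - 1) *
      (a + b * (Complex.exp (s * Complex.I) + Complex.exp (t * Complex.I)) +
        c * (Complex.exp (s * Complex.I) * Complex.exp (t * Complex.I))))) :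
    distVar μ = 4 * (a ^ 2 + 2 * b ^ 2 + c ^ 2) := by
  have hpi := Real.pi_ne_zero
  unfold distVar
  have := dbl a b c
  simp only [h, num_norm _ _ _ _ _ _ (hu _ _)]
  have e : ∀ q : ℝ × ℝ, (1 - Real.cos q.1) * (1 - Real.cos q.2) *
      (4 * (a ^ 2 + 2 * b ^ 2 + c ^ 2) + 8 * b * (a + c) * (Real.cos q.1 + Real.cos q.2)
        + 8 * a * c * Real.cos (q.1 + q.2) + 8 * b ^ 2 * Real.cos (q.1 - q.2)) /
        (q.1 ^ 2 * q.2 ^ 2) =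
      ((1 - Real.cos q.1) / q.1 ^ 2) * ((1 - Real.cos q.2) / q.2 ^ 2) *
      (4 * (a ^ 2 + 2 * b ^ 2 + c ^ 2) + 8 * b * (a + c) * (Real.cos q.1 + Real.cos q.2)
        + 8 * a * c * Real.cos (q.1 + q.2) + 8 * b ^ 2 * Real.cos (q.1 - q.2)) := by
    intro q
    rw [div_mul_div_comm, div_mul_eq_mul_div]
  simp only [e]
  rw [this]
  field_simp

instance bern_sfinite (p : ℝ) : SFinite (bern p) := by
  unfold bern; infer_instance

lemma charF_bern (p : ℝ) (hp0 : 0 < p) (hp1 : p < 1) (t : ℝ) :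
    charF (bern p) t = p * Complex.exp (t * Complex.I) + (1 - p) := by
  unfold charF bern
  have i : ∀ x : ℝ, Integrable (fun x : ℝ => Complex.exp ((t * x : ℝ) * Complex.I))
      (Measure.dirac x) := fun x => integrable_dirac (by simp)
  rw [integral_add_measure ((i 1).smul_measure (by simp)) ((i 0).smul_measure (by simp)),
    integral_smul_measure, integral_smul_measure, integral_dirac, integral_dirac,
    ENNReal.toReal_ofReal hp0.le, ENNReal.toReal_ofReal (by linarith)]
  simp

lemma charF_add (p t : ℝ) :
    charF (((bern p).prod (bern p)).map (fun q => q.1 + q.2)) t =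
      charF (bern p) t * charF (bern p) t := by
  unfold charF
  rw [integral_map (by fun_prop) (Measurable.aestronglyMeasurable (by fun_prop)),
    ← integral_prod_mul]
  congr 1; ext q
  rw [← Complex.exp_add]
  congr 1; push_cast; ring

lemma charF_sub (p t : ℝ) :
    charF (((bern p).prod (bern p)).map (fun q => q.1 - q.2)) t =
      charF (bern p) t * charF (bern p) (-t) := by
  unfold charF
  rw [integral_map (by fun_prop) (Measurable.aestronglyMeasurable (by fun_prop)),
    ← integral_prod_mul]
  congr 1; ext q
  rw [← Complex.exp_add]
  congr 1; push_cast; ring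

lemma distVar_add (p : ℝ) (hp0 : 0 < p) (hp1 : p < 1) :
    distVar (((bern p).prod (bern p)).map (fun q => q.1 + q.2)) =
      8 * (p - p ^ 2) ^ 2 * (2 * (p - p ^ 2) ^ 2 - 6 * (p - p ^ 2) + 2) := by
  rw [distVar_of _ (2 * p * (1 - p) ^ 3 + (p - p ^ 2) ^ 2) ((p - p ^ 2) ^ 2)
    (2 * p ^ 3 * (1 - p) + (p - p ^ 2) ^ 2) (fun _ _ => 1) (by simp)]
  · ring
  · intro s t
    simp only [charF_add, charF_bern p hp0 hp1]
    push_cast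
    rw [add_mul (s : ℂ) t Complex.I, Complex.exp_add]
    ring

lemma distVar_sub (p : ℝ) (hp0 : 0 < p) (hp1 : p < 1) :
    distVar (((bern p).prod (bern p)).map (fun q => q.1 - q.2)) =
      8 * (p - p ^ 2) ^ 2 * (2 * (p - p ^ 2) ^ 2 - 2 * (p - p ^ 2) + 1) := by
  rw [distVar_of _ ((p - p ^ 2) * (1 - (p - p ^ 2))) ((p - p ^ 2) ^ 2)
    ((p - p ^ 2) * (1 - (p - p ^ 2)))
    (fun s t => (Complex.exp (s * Complex.I) * Complex.exp (t * Complex.I))⁻¹)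
    (by intro s t; simp [Complex.norm_exp_ofReal_mul_I])]
  · ring
  · intro s t
    simp only [charF_sub, charF_bern p hp0 hp1]
    push_cast
    rw [neg_mul, neg_mul, neg_mul, Complex.exp_neg, Complex.exp_neg, Complex.exp_neg,
      add_mul (s : ℂ) t Complex.I,
      Complex.exp_add]
    have hx := Complex.exp_ne_zero (s * Complex.I)
    have hy := Complex.exp_ne_zero (t * Complex.I)
    generalize Complex.exp (s * Complex.I) = x at *
    generalize Complex.exp (t * Complex.I) = y at *
    field_simp
    ring

/-- For `X, Y` independent Bernoulli(p) with `0 < p < 1` and `p ≠ 1/2`,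
`V²(X+Y) - V²(X-Y) = 8(p-p²)²(1-2p)² > 0`; in particular `V²(X+Y) > V²(X-Y)`. -/
theorem distVar_add_gt_distVar_sub_bernoulli (p : ℝ) (hp0 : 0 < p) (hp1 : p < 1)
    (hp : p ≠ 1 / 2) :
    distVar (((bern p).prod (bern p)).map (fun q => q.1 + q.2)) -
        distVar (((bern p).prod (bern p)).map (fun q => q.1 - q.2)) =
      8 * (p - p ^ 2) ^ 2 * (1 - 2 * p) ^ 2 ∧
      distVar (((bern p).prod (bern p)).map (fun q => q.1 - q.2)) <
        distVar (((bern p).prod (bern p)).map (fun q => q.1 + q.2)) := by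
  rw [distVar_add p hp0 hp1, distVar_sub p hp0 hp1]
  have h : 0 < 8 * (p - p ^ 2) ^ 2 * (1 - 2 * p) ^ 2 := by
    have h1 : p - p ^ 2 ≠ 0 := by
      have : 0 < p - p ^ 2 := by nlinarith
      exact this.ne'
    have h2 : 1 - 2 * p ≠ 0 := fun h => hp (by linarith)
    positivity
  have e : 8 * (p - p ^ 2) ^ 2 * (2 * (p - p ^ 2) ^ 2 - 6 * (p - p ^ 2) + 2) -
      8 * (p - p ^ 2) ^ 2 * (2 * (p - p ^ 2) ^ 2 - 2 * (p - p ^ 2) + 1) =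
      8 * (p - p ^ 2) ^ 2 * (1 - 2 * p) ^ 2 := by ring
  exact ⟨e, by linarith⟩
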